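/- Let s > 3/2 and s−1 ≤ s' ≤ s+1. There exists a constant C > 0, depending only on s and s', such that for all Schwartz vector fields u, j : ℝ³ → ℝ³ one has ∥(u·∇)j∥_{H^{s−1}} ≤ C ∥u∥_{H^{s'}} ∥∇j∥_{H^s}. -/

import Mathlib

open MeasureTheory SchwartzMap Real
open scoped FourierTransform

noncomputable section

/-- `ℝ³` as a Euclidean space. -/
abbrev E3 : Type := EuclideanSpace ℝ (Fin 3)

/-- The (squared-integral based) Sobolev `H^σ` norm of a complex-valued function on `ℝ³`,
defined via the Fourier transform. -/
noncomputable def HNorm (σ : ℝ) (f : E3 → ℂ) : ℝ :=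
  (∫ ξ : E3, (1 + ‖ξ‖ ^ 2) ^ σ * ‖𝓕 f ξ‖ ^ 2) ^ ((1 : ℝ) / 2)

/-- The Sobolev `H^σ` norm of a real-valued function. -/
noncomputable def HNormR (σ : ℝ) (f : E3 → ℝ) : ℝ :=
  HNorm σ (fun x => (f x : ℂ))

/-- The `j`-th partial derivative of a real-valued function on `ℝ³`. -/
noncomputable def pdR (j : Fin 3) (f : E3 → ℝ) : E3 → ℝ :=
  fun x => fderiv ℝ f x (EuclideanSpace.single j 1)

/-- The `j`-th partial derivative of a complex-valued function on `ℝ³`. -/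
noncomputable def pdC (j : Fin 3) (f : E3 → ℂ) : E3 → ℂ :=
  fun x => fderiv ℝ f x (EuclideanSpace.single j 1)

/-- The Sobolev `H^σ` norm of a vector field `u : ℝ³ → ℝ³`:
`∥u∥_{H^σ}² = Σ_i ∥u_i∥_{H^σ}²`. -/
noncomputable def VNorm (σ : ℝ) (u : Fin 3 → E3 → ℝ) : ℝ :=
  (∑ i : Fin 3, (HNormR σ (u i)) ^ 2) ^ ((1 : ℝ) / 2)

/-- `∥∇u∥_{H^σ}² = Σ_{i,j} ∥∂_j u_i∥_{H^σ}²` for a vector field `u : ℝ³ → ℝ³`. -/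
noncomputable def GradVNorm (σ : ℝ) (u : Fin 3 → E3 → ℝ) : ℝ :=
  (∑ i : Fin 3, ∑ j : Fin 3, (HNormR σ (pdR j (u i))) ^ 2) ^ ((1 : ℝ) / 2)

/-- The advection term `(u·∇)v`, with components `Σ_j u_j ∂_j v_i`. -/
noncomputable def adv (u v : Fin 3 → E3 → ℝ) : Fin 3 → E3 → ℝ :=
  fun i x => ∑ j : Fin 3, u j x * pdR j (v i) x

/-- The pointwise cross product of two vector fields on `ℝ³`. -/
noncomputable def crossVF (u v : Fin 3 → E3 → ℝ) : Fin 3 → E3 → ℝ :=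
  fun i x =>
    ![u 1 x * v 2 x - u 2 x * v 1 x,
      u 2 x * v 0 x - u 0 x * v 2 x,
      u 0 x * v 1 x - u 1 x * v 0 x] i

/-- A Schwartz vector field, viewed as a plain vector field. -/
noncomputable def toVF (u : Fin 3 → SchwartzMap E3 ℝ) : Fin 3 → E3 → ℝ :=
  fun i => ⇑(u i)

theorem sq_lintegral_mul_le {α : Type*} [MeasurableSpace α] {μ : Measure α} {f g : α → ENNReal}
    (hf : AEMeasurable f μ) (hg : AEMeasurable g μ) :
    (∫⁻ a, f a * g a ∂μ) ^ 2 ≤ (∫⁻ a, f a ^ 2 ∂μ) * ∫⁻ a, g a ^ 2 ∂μ := by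
  have h := ENNReal.lintegral_mul_le_Lp_mul_Lq μ Real.HolderConjugate.two_two hf hg
  calc _ ≤ _ := pow_le_pow_left' h 2
    _ = _ := by
      simp only [mul_pow, ← ENNReal.rpow_natCast, ← ENNReal.rpow_mul]
      norm_num

section Kernel

variable {V : Type*} [NormedAddCommGroup V]

theorem one_add_norm_add_sq_rpow_mul_le {t s : ℝ} (ht : 0 ≤ t) (hts : t ≤ s) (y z : V) :
    (1 + ‖y + z‖ ^ 2) ^ (t / 2) ≤
      4 ^ (t / 2) * ((1 + ‖y‖ ^ 2) ^ (-s / 2) + (1 + ‖z‖ ^ 2) ^ (-s / 2)) *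
        ((1 + ‖y‖ ^ 2) ^ (t / 2) * (1 + ‖z‖ ^ 2) ^ (s / 2)) := by
  have hyz : ‖y + z‖ ^ 2 ≤ 2 * (‖y‖ ^ 2 + ‖z‖ ^ 2) := by
    nlinarith [norm_add_le y z, norm_nonneg (y + z), sq_nonneg (‖y‖ - ‖z‖)]
  have hx : 0 < 1 + ‖y + z‖ ^ 2 := by positivity
  generalize 1 + ‖y + z‖ ^ 2 = x, hX : 1 + ‖y + z‖ ^ 2 = x at *
  have hp : 0 < 1 + ‖y‖ ^ 2 := by positivity
  have hq : 0 < 1 + ‖z‖ ^ 2 := by positivity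
  have hxp : x ≤ 2 * ((1 + ‖y‖ ^ 2) + (1 + ‖z‖ ^ 2)) := by linarith
  generalize 1 + ‖y‖ ^ 2 = p at *
  generalize 1 + ‖z‖ ^ 2 = q at *
  have hc : (0 : ℝ) < 4 ^ (t / 2) := by positivity
  rcases le_total q p with h | h
  · calc x ^ (t / 2) ≤ (4 * p) ^ (t / 2) := by gcongr; linarith
      _ = 4 ^ (t / 2) * (q ^ (-s / 2)) * (p ^ (t / 2) * q ^ (s / 2)) := by
        rw [mul_rpow (by norm_num) hp.le, neg_div, rpow_neg hq.le]
        field_simp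
      _ ≤ _ := by
        gcongr
        exact le_add_of_nonneg_left (by positivity)
  · calc x ^ (t / 2) ≤ (4 * q) ^ (t / 2) := by gcongr; linarith
      _ = 4 ^ (t / 2) * (q ^ (-(s - t) / 2) * q ^ (s / 2)) := by
        rw [mul_rpow (by norm_num) hq.le, ← rpow_add hq]
        ring_nf
      _ ≤ 4 ^ (t / 2) * (p ^ (-(s - t) / 2) * q ^ (s / 2)) := by
        gcongr 4 ^ (t / 2) * (?_ * q ^ (s / 2))
        exact rpow_le_rpow_of_nonpos hp h (by linarith)
      _ = 4 ^ (t / 2) * (p ^ (-s / 2)) * (p ^ (t / 2) * q ^ (s / 2)) := by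
        rw [show -(s - t) / 2 = -s / 2 + t / 2 by ring, rpow_add hp]
        ring
      _ ≤ _ := by
        gcongr
        exact le_add_of_nonneg_right (by positivity)

variable [InnerProductSpace ℝ V] [FiniteDimensional ℝ V] [MeasurableSpace V] [BorelSpace V]

theorem lintegral_japanese_kernel_sq_le (t : ℝ) {s : ℝ} (hs : (Module.finrank ℝ V : ℝ) < 2 * s) :
    ∃ M : ℝ, 0 < M ∧ ∀ ξ : V, ∫⁻ y : V, ENNReal.ofReal (4 ^ (t / 2) *
      ((1 + ‖y‖ ^ 2) ^ (-s / 2) + (1 + ‖ξ - y‖ ^ 2) ^ (-s / 2))) ^ 2 ≤ ENNReal.ofReal M := by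
  have hint : Integrable (fun y : V ↦ (1 + ‖y‖ ^ 2) ^ (-s)) := by
    convert! integrable_rpow_neg_one_add_norm_sq (E := V) (μ := volume) hs using 3
    ring
  have hI : 0 ≤ ∫ y : V, (1 + ‖y‖ ^ 2) ^ (-s) := by positivity
  refine ⟨(2 * 4 ^ t) * (2 * ∫ y : V, (1 + ‖y‖ ^ 2) ^ (-s)) + 1, by positivity, fun ξ ↦ ?_⟩
  have hint' := hint.comp_sub_left ξ
  have hsq (x : ℝ) (hx : 0 < x) : (x ^ (-s / 2)) ^ 2 = x ^ (-s) := by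
    rw [← rpow_natCast, ← rpow_mul hx.le]
    norm_num
  calc _ ≤ ∫⁻ y : V, ENNReal.ofReal
        ((2 * 4 ^ t) * ((1 + ‖y‖ ^ 2) ^ (-s) + (1 + ‖ξ - y‖ ^ 2) ^ (-s))) := by
        refine lintegral_mono fun y ↦ ?_
        rw [← ENNReal.ofReal_pow (by positivity)]
        refine ENNReal.ofReal_le_ofReal ?_
        rw [← hsq (1 + ‖y‖ ^ 2) (by positivity), ← hsq (1 + ‖ξ - y‖ ^ 2) (by positivity), mul_pow,
          show ((4 : ℝ) ^ (t / 2)) ^ 2 = 4 ^ t by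
            rw [← rpow_natCast, ← rpow_mul (by norm_num)]; norm_num, mul_comm 2, mul_assoc]
        gcongr
        exact add_sq_le
    _ = ENNReal.ofReal ((2 * 4 ^ t) * (2 * ∫ y : V, (1 + ‖y‖ ^ 2) ^ (-s))) := by
        rw [← ofReal_integral_eq_lintegral_ofReal ((hint.fun_add hint').const_mul _)
          (.of_forall fun y ↦ by positivity), integral_const_mul, integral_add hint hint',
          integral_sub_left_eq_self (fun y : V ↦ (1 + ‖y‖ ^ 2) ^ (-s)) volume ξ]
        ring_nf
    _ ≤ _ := ENNReal.ofReal_le_ofReal (by linarith)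

theorem lintegral_weighted_convolution_le {t s : ℝ} (ht : 0 ≤ t) (hts : t ≤ s)
    (hs : (Module.finrank ℝ V : ℝ) < 2 * s) :
    ∃ M : ℝ, 0 < M ∧ ∀ a b : V → ℂ, Continuous a → Continuous b →
      ∫⁻ ξ, ENNReal.ofReal ((1 + ‖ξ‖ ^ 2) ^ t * ‖∫ y, a y * b (ξ - y)‖ ^ 2) ≤
        ENNReal.ofReal M * ((∫⁻ y, ENNReal.ofReal ((1 + ‖y‖ ^ 2) ^ t * ‖a y‖ ^ 2)) *
          ∫⁻ z, ENNReal.ofReal ((1 + ‖z‖ ^ 2) ^ s * ‖b z‖ ^ 2)) := by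
  obtain ⟨M, hM, hK⟩ := lintegral_japanese_kernel_sq_le (V := V) t hs
  refine ⟨M, hM, fun a b ha hb ↦ ?_⟩
  have hsq (x r c : ℝ) (hx : 0 < x) : x ^ r * c ^ 2 = (x ^ (r / 2) * c) ^ 2 := by
    rw [mul_pow, ← rpow_natCast (x ^ (r / 2)), ← rpow_mul hx.le]
    norm_num
  have hA : Measurable fun y : V ↦ ENNReal.ofReal ((1 + ‖y‖ ^ 2) ^ t * ‖a y‖ ^ 2) := by fun_prop
  have hB : Measurable fun y : V ↦ ENNReal.ofReal ((1 + ‖y‖ ^ 2) ^ s * ‖b y‖ ^ 2) := by fun_prop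
  have key (ξ : V) : ENNReal.ofReal ((1 + ‖ξ‖ ^ 2) ^ t * ‖∫ y, a y * b (ξ - y)‖ ^ 2) ≤
      ENNReal.ofReal M * ∫⁻ y, ENNReal.ofReal ((1 + ‖y‖ ^ 2) ^ t * ‖a y‖ ^ 2) *
        ENNReal.ofReal ((1 + ‖ξ - y‖ ^ 2) ^ s * ‖b (ξ - y)‖ ^ 2) := by
    calc _ = (ENNReal.ofReal ((1 + ‖ξ‖ ^ 2) ^ (t / 2)) * ‖∫ y, a y * b (ξ - y)‖ₑ) ^ 2 := by
          rw [hsq _ _ _ (by positivity), ENNReal.ofReal_pow (by positivity),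
            ENNReal.ofReal_mul (by positivity), ofReal_norm]
      _ ≤ (ENNReal.ofReal ((1 + ‖ξ‖ ^ 2) ^ (t / 2)) * ∫⁻ y, ‖a y * b (ξ - y)‖ₑ) ^ 2 := by
          gcongr
          exact enorm_integral_le_lintegral_enorm _
      _ ≤ (∫⁻ y : V, ENNReal.ofReal (4 ^ (t / 2) *
            ((1 + ‖y‖ ^ 2) ^ (-s / 2) + (1 + ‖ξ - y‖ ^ 2) ^ (-s / 2))) *
            ENNReal.ofReal (((1 + ‖y‖ ^ 2) ^ (t / 2) * ‖a y‖) *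
              ((1 + ‖ξ - y‖ ^ 2) ^ (s / 2) * ‖b (ξ - y)‖))) ^ 2 := by
          rw [← lintegral_const_mul' _ _ ENNReal.ofReal_ne_top]
          refine pow_le_pow_left' (lintegral_mono fun y ↦ ?_) 2
          rw [← ofReal_norm, ← ENNReal.ofReal_mul (by positivity),
            ← ENNReal.ofReal_mul (by positivity), norm_mul]
          refine ENNReal.ofReal_le_ofReal ?_
          have h := one_add_norm_add_sq_rpow_mul_le ht hts y (ξ - y)
          rw [add_sub_cancel] at h
          refine (mul_le_mul_of_nonneg_right h (by positivity)).trans_eq ?_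
          ring
      _ ≤ _ := by
          refine (sq_lintegral_mul_le (by fun_prop) (by fun_prop)).trans ?_
          gcongr with y
          · exact hK ξ
          · rw [hsq _ _ _ (by positivity), hsq (1 + ‖ξ - y‖ ^ 2) _ _ (by positivity),
              ← ENNReal.ofReal_mul (by positivity), ← ENNReal.ofReal_pow (by positivity), mul_pow]
  refine (lintegral_mono key).trans ?_
  rw [lintegral_const_mul' _ _ ENNReal.ofReal_ne_top, lintegral_lintegral_swap
    (((hA.comp measurable_snd).mul (hB.comp (measurable_fst.sub measurable_snd))).aemeasurable)]
  gcongr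
  rw [← lintegral_mul_const _ hA]
  refine lintegral_mono fun y ↦ ?_
  rw [lintegral_const_mul' _ _ ENNReal.ofReal_ne_top,
    lintegral_sub_right_eq_self (fun z ↦ ENNReal.ofReal ((1 + ‖z‖ ^ 2) ^ s * ‖b z‖ ^ 2)) y]

theorem SchwartzMap.fourier_pairing_mul_apply (f g : 𝓢(V, ℂ)) (ξ : V) :
    𝓕 (pairing (ContinuousLinearMap.mul ℂ ℂ) f g) ξ = ∫ y, 𝓕 f y * 𝓕 g (ξ - y) := by
  set B := ContinuousLinearMap.mul ℂ ℂ
  have hinv (h : 𝓢(V, ℂ)) (x : V) : 𝓕⁻ h x = 𝓕 h (-x) := by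
    rw [fourierInv_coe, fourier_coe, Real.fourierInv_eq_fourier_neg]
  have h : pairing B f g = 𝓕 (convolution B (𝓕⁻ f) (𝓕⁻ g)) := by
    rw [fourier_convolution]
    simp
  have h2 : 𝓕 (pairing B f g) ξ = convolution B (𝓕⁻ f) (𝓕⁻ g) (-ξ) := by
    rw [← neg_neg ξ, ← hinv, h]
    simp
  rw [h2, convolution_apply, MeasureTheory.convolution_def, ← integral_neg_eq_self]
  refine integral_congr_ae (.of_forall fun y ↦ ?_)
  simp only [B, ContinuousLinearMap.mul_apply', hinv]
  congr 2 <;> simp [sub_eq_add_neg, add_comm]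

theorem SchwartzMap.integrable_rpow_mul_norm_sq (σ : ℝ) (f : 𝓢(V, ℂ)) :
    Integrable fun ξ ↦ (1 + ‖ξ‖ ^ 2) ^ σ * ‖f ξ‖ ^ 2 := by
  have hg := Function.hasTemperateGrowth_one_add_norm_sq_rpow V (σ / 2)
  have h := ((smulLeftCLM ℂ (fun x : V ↦ (1 + ‖x‖ ^ 2) ^ (σ / 2)) f).memLp 2).integrable_norm_pow
    (by norm_num)
  refine h.congr (.of_forall fun ξ ↦ ?_)
  have h0 : (0 : ℝ) < 1 + ‖ξ‖ ^ 2 := by positivity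
  simp only [smulLeftCLM_apply_apply hg, norm_smul, mul_pow, Real.norm_eq_abs, sq_abs]
  rw [← rpow_natCast (_ ^ (σ / 2)), ← rpow_mul h0.le]
  norm_num

end Kernel

theorem HNorm_nonneg (σ : ℝ) (f : E3 → ℂ) : 0 ≤ HNorm σ f := by
  unfold HNorm
  positivity

theorem HNorm_sq (σ : ℝ) (f : E3 → ℂ) :
    HNorm σ f ^ 2 = ∫ ξ : E3, (1 + ‖ξ‖ ^ 2) ^ σ * ‖𝓕 f ξ‖ ^ 2 := by
  rw [HNorm, ← Real.sqrt_eq_rpow, Real.sq_sqrt (by positivity)]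

theorem ofReal_HNorm_sq (σ : ℝ) (f : 𝓢(E3, ℂ)) :
    ENNReal.ofReal (HNorm σ f ^ 2) =
      ∫⁻ ξ : E3, ENNReal.ofReal ((1 + ‖ξ‖ ^ 2) ^ σ * ‖𝓕 f ξ‖ ^ 2) := by
  rw [HNorm_sq, ← fourier_coe, ofReal_integral_eq_lintegral_ofReal
    ((𝓕 f).integrable_rpow_mul_norm_sq σ) (.of_forall fun ξ ↦ by positivity)]

theorem HNorm_sq_mono {σ τ : ℝ} (h : σ ≤ τ) (f : 𝓢(E3, ℂ)) : HNorm σ f ^ 2 ≤ HNorm τ f ^ 2 := by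
  rw [HNorm_sq, HNorm_sq, ← fourier_coe]
  refine integral_mono ((𝓕 f).integrable_rpow_mul_norm_sq σ) ((𝓕 f).integrable_rpow_mul_norm_sq τ)
    fun ξ ↦ ?_
  dsimp only
  gcongr
  nlinarith [sq_nonneg ‖ξ‖]

theorem HNorm_sum_sq_le (σ : ℝ) (f : Fin 3 → 𝓢(E3, ℂ)) :
    HNorm σ (∑ j, f j : 𝓢(E3, ℂ)) ^ 2 ≤ 3 * ∑ j, HNorm σ (f j) ^ 2 := by
  simp only [HNorm_sq, ← fourier_coe]
  rw [← integral_finsetSum _ fun j _ ↦ (𝓕 (f j)).integrable_rpow_mul_norm_sq σ,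
    ← integral_const_mul]
  refine integral_mono ((𝓕 (∑ j, f j)).integrable_rpow_mul_norm_sq σ)
    ((integrable_finsetSum _ fun j _ ↦
      (𝓕 (f j)).integrable_rpow_mul_norm_sq σ).const_mul _) fun ξ ↦ ?_
  have hF : 𝓕 (∑ j, f j) = ∑ j, 𝓕 (f j) := map_sum (FourierTransform.fourierCLM ℂ 𝓢(E3, ℂ)) f Finset.univ
  dsimp only
  rw [hF, sum_apply, ← Finset.mul_sum, mul_left_comm]
  gcongr
  calc _ ≤ (∑ j, ‖𝓕 (f j) ξ‖) ^ 2 := by gcongr; exact norm_sum_le _ _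
    _ ≤ _ := by simpa using sq_sum_le_card_mul_sum_sq (s := Finset.univ) (f := fun j ↦ ‖𝓕 (f j) ξ‖)

theorem exists_HNorm_mul_sq_le {t s : ℝ} (ht : 0 ≤ t) (hts : t ≤ s) (hs : 3 / 2 < s) :
    ∃ M : ℝ, 0 < M ∧ ∀ f g : 𝓢(E3, ℂ),
      HNorm t (pairing (ContinuousLinearMap.mul ℂ ℂ) f g) ^ 2 ≤
        M * (HNorm t f ^ 2 * HNorm s g ^ 2) := by
  have hfin : (Module.finrank ℝ E3 : ℝ) < 2 * s := by
    simp only [finrank_euclideanSpace, Fintype.card_fin]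
    push_cast
    linarith
  obtain ⟨M, hM, h⟩ := lintegral_weighted_convolution_le ht hts hfin
  refine ⟨M, hM, fun f g ↦ ?_⟩
  rw [← ENNReal.ofReal_le_ofReal_iff (by positivity), ENNReal.ofReal_mul hM.le,
    ENNReal.ofReal_mul (by positivity), ofReal_HNorm_sq, ofReal_HNorm_sq, ofReal_HNorm_sq]
  simpa only [fourier_pairing_mul_apply] using h _ _ (𝓕 f).continuous (𝓕 g).continuous

/-- The complexification of a real-valued Schwartz function. -/
def SchwartzMap.complexify (f : 𝓢(E3, ℝ)) : 𝓢(E3, ℂ) := f.postcompCLM Complex.ofRealCLM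

theorem HNormR_eq_complexify (σ : ℝ) (f : 𝓢(E3, ℝ)) : HNormR σ f = HNorm σ f.complexify := rfl

theorem pdR_eq_lineDerivOp (j : Fin 3) (f : 𝓢(E3, ℝ)) :
    pdR j f = (LineDeriv.lineDerivOp (EuclideanSpace.single j (1 : ℝ)) f : 𝓢(E3, ℝ)) := by
  ext x
  rw [lineDerivOp_apply_eq_fderiv, pdR]

theorem exists_HNormR_adv_sq_le {s s' : ℝ} (hs : 3 / 2 < s) (hs' : s - 1 ≤ s') :
    ∃ M : ℝ, 0 < M ∧ ∀ (u v : Fin 3 → 𝓢(E3, ℝ)) (i : Fin 3),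
      HNormR (s - 1) (adv (toVF u) (toVF v) i) ^ 2 ≤
        M * ∑ j, HNormR s' (u j) ^ 2 * HNormR s (pdR j (v i)) ^ 2 := by
  obtain ⟨M, hM, h⟩ := exists_HNorm_mul_sq_le (t := s - 1) (by linarith) (by linarith) hs
  refine ⟨3 * M, by positivity, fun u v i ↦ ?_⟩
  simp only [pdR_eq_lineDerivOp, HNormR_eq_complexify]
  set d := fun j : Fin 3 ↦ (LineDeriv.lineDerivOp (EuclideanSpace.single j (1 : ℝ)) (v i) : 𝓢(E3, ℝ))
  have hadv : HNormR (s - 1) (adv (toVF u) (toVF v) i) = HNorm (s - 1) (∑ j, pairing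
      (ContinuousLinearMap.mul ℂ ℂ) (u j).complexify (d j).complexify : 𝓢(E3, ℂ)) := by
    unfold HNormR
    congr 1
    ext x
    simp only [adv, toVF, pdR_eq_lineDerivOp, sum_apply]
    push_cast
    rfl
  rw [hadv, mul_assoc, Finset.mul_sum]
  refine (HNorm_sum_sq_le _ _).trans ?_
  gcongr with j
  refine (h _ _).trans ?_
  gcongr M * (?_ * _)
  exact HNorm_sq_mono hs' _

/-- Lemma 2.7: `∥(u·∇)j∥_{H^{s−1}} ≤ C ∥u∥_{H^{s'}} ∥∇j∥_{H^s}`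
for `s > 3/2`, `s−1 ≤ s' ≤ s+1` and Schwartz vector fields `u, j`. -/
theorem advection_estimate_uj' (s s' : ℝ) (hs : 3 / 2 < s)
    (hs'1 : s - 1 ≤ s') (hs'2 : s' ≤ s + 1) :
    ∃ C : ℝ, 0 < C ∧ ∀ u j : Fin 3 → SchwartzMap E3 ℝ,
      VNorm (s - 1) (adv (toVF u) (toVF j)) ≤
        C * VNorm s' (toVF u) * GradVNorm s (toVF j) := by
  obtain ⟨M, hM, h⟩ := exists_HNormR_adv_sq_le hs hs'1
  refine ⟨√M, Real.sqrt_pos.2 hM, fun u j ↦ ?_⟩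
  simp only [VNorm, GradVNorm, ← Real.sqrt_eq_rpow]
  rw [← Real.sqrt_mul hM.le, ← Real.sqrt_mul (by positivity)]
  refine Real.sqrt_le_sqrt ?_
  calc _ ≤ ∑ i, M * ∑ k, HNormR s' (u k) ^ 2 * HNormR s (pdR k (j i)) ^ 2 :=
        Finset.sum_le_sum fun i _ ↦ h u j i
    _ ≤ ∑ i, M * ∑ k, (∑ l, HNormR s' (u l) ^ 2) * HNormR s (pdR k (j i)) ^ 2 := by
        gcongr with i _ k _
        exact Finset.single_le_sum (f := fun l ↦ HNormR s' (u l) ^ 2)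
          (fun l _ ↦ by positivity) (Finset.mem_univ k)
    _ = _ := by simp only [← Finset.mul_sum, mul_assoc, toVF]

end
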